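/- (Pollicott–Weiss) The exceptional set E = { β ∈ (0,1) : β irrational and lim_{n→∞} (1/n) log q_n(β) does not exist } has Lebesgue measure zero and Hausdorff dimension equal to 1. -/

import Mathlib

open Filter MeasureTheory

open Topology

/-- The Gauss map `T 0 = 0`, `T x = 1/x - ⌊1/x⌋` for `x ≠ 0`. -/
noncomputable def gaussMap (x : ℝ) : ℝ :=
  if x = 0 then 0 else 1 / x - (⌊1 / x⌋ : ℝ)

/-- The `n`-th continued fraction digit of `β` (for `n ≥ 1`): `a_n(β) = ⌊1/(T^{n-1} β)⌋`. -/
noncomputable def digit (β : ℝ) (n : ℕ) : ℤ :=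
  ⌊1 / (gaussMap^[n - 1] β)⌋

/-- Convergent denominators (`qq a (k+1) = q_k`, `q_{-1}=0`, `q_0=1`). -/
def qq (a : ℕ → ℤ) : ℕ → ℤ
  | 0 => 0
  | 1 => 1
  | k + 2 => a (k + 1) * qq a (k + 1) + qq a k

/-- `qDen β (n+1) = q_n(β)`, the denominator of the `n`-th convergent of `β`. -/
noncomputable def qDen (β : ℝ) : ℕ → ℤ := qq (digit β)

/-- The exceptional set of irrational `β ∈ (0,1)` for which `lim (1/n) log q_n(β)` does
not exist. -/
noncomputable def exceptionalSet : Set ℝ :=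
  {β | β ∈ Set.Ioo (0 : ℝ) 1 ∧ Irrational β ∧
    ¬∃ L : ℝ, Tendsto (fun n : ℕ => Real.log (qDen β (n + 1)) / n) atTop (nhds L)}

section Birkhoff

variable {α : Type*} {T : α → α} {f : α → ℝ}

/-- The maximal Birkhoff sum `max_{0 ≤ k ≤ n} ∑_{i < k} f (T^i x)`, in recursive form. -/
noncomputable def birkhoffMax (T : α → α) (f : α → ℝ) : ℕ → α → ℝ
  | 0 => fun _ => 0
  | n + 1 => fun x => max 0 (f x + birkhoffMax T f n (T x))

lemma birkhoffMax_nonneg (n : ℕ) (x : α) : 0 ≤ birkhoffMax T f n x := by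
  cases n with
  | zero => exact le_rfl
  | succ n => exact le_max_left _ _

lemma birkhoffMax_le_succ (n : ℕ) (x : α) : birkhoffMax T f n x ≤ birkhoffMax T f (n + 1) x := by
  induction n generalizing x with
  | zero => exact birkhoffMax_nonneg 1 x
  | succ n ih => exact max_le_max le_rfl (by linarith [ih (T x)])

lemma birkhoffMax_monotone (x : α) : Monotone fun n => birkhoffMax T f n x :=
  monotone_nat_of_le_succ fun n => birkhoffMax_le_succ n x

lemma birkhoffSum_le_birkhoffMax (n : ℕ) (x : α) :
    birkhoffSum T f n x ≤ birkhoffMax T f n x := by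
  induction n generalizing x with
  | zero => simp [birkhoffMax]
  | succ n ih =>
    rw [birkhoffSum_succ']
    exact le_trans (by linarith [ih (T x)]) (le_max_right _ _)

lemma birkhoffSum_neg_apply (n : ℕ) (x : α) :
    birkhoffSum T (fun y => -f y) n x = -birkhoffSum T f n x := by
  simp [birkhoffSum]

/-- The points whose Birkhoff averages have lower limit strictly below `a`. -/
def birkhoffLow (T : α → α) (f : α → ℝ) (a : ℝ) : Set α :=
  {x | ∃ r : ℚ, (r : ℝ) < a ∧ ∃ᶠ n : ℕ in atTop, birkhoffSum T f n x < r * n}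

lemma preimage_birkhoffLow (a : ℝ) : T ⁻¹' birkhoffLow T f a = birkhoffLow T f a := by
  have large : ∀ (c : ℝ) {d : ℝ}, 0 < d → ∀ᶠ n : ℕ in atTop, c < d * n := fun c d hd =>
    (tendsto_natCast_atTop_atTop.const_mul_atTop hd).eventually_gt_atTop c
  ext x
  constructor
  · rintro ⟨r, hra, hr⟩
    obtain ⟨r', h1, h2⟩ := exists_rat_btwn hra
    refine ⟨r', h2, ?_⟩
    have := (hr.and_eventually (large (f x - r') (sub_pos.2 h1))).mono
      (q := fun n => birkhoffSum T f (n + 1) x < r' * (n + 1 : ℕ)) ?_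
    · exact (tendsto_add_atTop_nat 1).frequently this
    · rintro n ⟨hn1, hn2⟩
      rw [birkhoffSum_succ']
      push_cast
      linarith
  · rintro ⟨r, hra, hr⟩
    obtain ⟨r', h1, h2⟩ := exists_rat_btwn hra
    refine ⟨r', h2, ?_⟩
    have hr1 : ∃ᶠ n : ℕ in atTop, birkhoffSum T f (n + 1) x < r * (n + 1 : ℕ) := by
      rw [frequently_atTop] at hr ⊢
      intro N
      obtain ⟨n, hn, hlt⟩ := hr (N + 1)
      exact ⟨n - 1, by omega, by rwa [Nat.sub_add_cancel (by omega)]⟩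
    refine (hr1.and_eventually (large (r - f x) (sub_pos.2 h1))).mono ?_
    rintro n ⟨hn1, hn2⟩
    rw [birkhoffSum_succ'] at hn1
    push_cast at hn1
    linarith

lemma eventually_le_of_notMem_birkhoffLow {a : ℝ} {r : ℚ} (hr : (r : ℝ) < a) {x : α}
    (hx : x ∉ birkhoffLow T f a) : ∀ᶠ n : ℕ in atTop, (r : ℝ) ≤ birkhoffSum T f n x / n := by
  have h : ¬∃ᶠ n : ℕ in atTop, birkhoffSum T f n x < r * n := fun h => hx ⟨r, hr, h⟩
  rw [not_frequently] at h
  filter_upwards [h, eventually_gt_atTop 0] with n hn hn0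
  rw [le_div_iff₀ (by exact_mod_cast hn0)]
  exact not_lt.1 hn

lemma mem_birkhoffLow_of_frequently {a : ℝ} {r : ℚ} (hr : (r : ℝ) < a) {x : α}
    (hx : ∃ᶠ n : ℕ in atTop, birkhoffSum T f n x / n < r) : x ∈ birkhoffLow T f a := by
  by_contra h
  refine hx ?_
  filter_upwards [eventually_le_of_notMem_birkhoffLow hr h] with n hn
  exact not_lt.2 hn

variable [MeasurableSpace α] {μ : Measure α}

lemma measurable_birkhoffMax (hT : Measurable T) (hf : Measurable f) (n : ℕ) :
    Measurable (birkhoffMax T f n) := by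
  induction n with
  | zero => exact measurable_const
  | succ n ih => exact measurable_const.max (hf.add (ih.comp hT))

lemma measurable_birkhoffSum (hT : Measurable T) (hf : Measurable f) (n : ℕ) :
    Measurable (birkhoffSum T f n) :=
  Finset.measurable_fun_sum _ fun k _ => hf.comp (hT.iterate k)

lemma integrable_birkhoffMax (hT : MeasurePreserving T μ μ) (hf : Integrable f μ) (n : ℕ) :
    Integrable (birkhoffMax T f n) μ := by
  induction n with
  | zero => exact integrable_zero _ _ _
  | succ n ih =>
    exact (integrable_zero _ _ _).sup (hf.add (hT.integrable_comp_of_integrable ih))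

/-- The maximal ergodic inequality for finitely many Birkhoff sums. -/
lemma setIntegral_birkhoffMax_pos_nonneg (hT : MeasurePreserving T μ μ) (hfm : Measurable f)
    (hf : Integrable f μ) (n : ℕ) : 0 ≤ ∫ x in {x | 0 < birkhoffMax T f n x}, f x ∂μ := by
  cases n with
  | zero => simp [birkhoffMax]
  | succ n =>
    have hM := measurable_birkhoffMax hT.measurable hfm (n + 1)
    have hMi := integrable_birkhoffMax hT hf (n + 1)
    have hMTi : Integrable (fun x => birkhoffMax T f (n + 1) (T x)) μ :=
      hT.integrable_comp_of_integrable hMi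
    set s := {x | 0 < birkhoffMax T f (n + 1) x}
    have hs : MeasurableSet s := measurableSet_lt measurable_const hM
    have h1 : ∫ x in s, birkhoffMax T f (n + 1) x ∂μ = ∫ x, birkhoffMax T f (n + 1) x ∂μ := by
      rw [← integral_indicator hs]
      congr 1
      ext x
      by_cases hx : x ∈ s
      · simp [hx]
      · rw [Set.indicator_of_notMem hx]
        exact le_antisymm (birkhoffMax_nonneg _ _) (not_lt.1 hx)
    have h2 : ∫ x in s, birkhoffMax T f (n + 1) (T x) ∂μ ≤ ∫ x, birkhoffMax T f (n + 1) x ∂μ := by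
      have hmap : ∫ x, birkhoffMax T f (n + 1) (T x) ∂μ = ∫ x, birkhoffMax T f (n + 1) x ∂μ := by
        conv_rhs => rw [← hT.map_eq]
        exact (integral_map hT.aemeasurable hM.aestronglyMeasurable).symm
      rw [← hmap]
      exact setIntegral_le_integral hMTi (Eventually.of_forall fun x => birkhoffMax_nonneg _ _)
    have h3 : ∫ x in s, (birkhoffMax T f (n + 1) x - birkhoffMax T f (n + 1) (T x)) ∂μ ≤
        ∫ x in s, f x ∂μ := by
      refine setIntegral_mono_on (hMi.sub hMTi).integrableOn hf.integrableOn hs fun x hx => ?_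
      have hx' : 0 < max 0 (f x + birkhoffMax T f n (T x)) := hx
      have hx2 : birkhoffMax T f (n + 1) x = f x + birkhoffMax T f n (T x) :=
        max_eq_right (by
          by_contra h
          rw [max_eq_left (le_of_not_ge h)] at hx'
          exact lt_irrefl _ hx')
      linarith [birkhoffMax_le_succ (T := T) (f := f) n (T x)]
    rw [integral_sub hMi.integrableOn hMTi.integrableOn] at h3
    linarith

/-- The maximal ergodic theorem, when almost every point has a positive Birkhoff sum. -/
lemma integral_nonneg_of_exists_birkhoffSum_pos (hT : MeasurePreserving T μ μ)
    (hfm : Measurable f) (hf : Integrable f μ) (h : ∀ᵐ x ∂μ, ∃ n, 0 < birkhoffSum T f n x) :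
    0 ≤ ∫ x, f x ∂μ := by
  have hlim := tendsto_setIntegral_of_monotone (μ := μ) (f := f)
    (s := fun n => {x | 0 < birkhoffMax T f n x})
    (fun n => measurableSet_lt measurable_const (measurable_birkhoffMax hT.measurable hfm n))
    (fun m n hmn x hx => lt_of_lt_of_le hx (birkhoffMax_monotone x hmn)) hf.integrableOn
  have huniv : (⋃ n, {x | 0 < birkhoffMax T f n x}) =ᵐ[μ] Set.univ := by
    refine eventuallyEq_univ.2 ?_
    filter_upwards [h] with x hx
    obtain ⟨n, hn⟩ := hx
    exact Set.mem_iUnion.2 ⟨n, hn.trans_le (birkhoffSum_le_birkhoffMax n x)⟩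
  rw [setIntegral_congr_set huniv, setIntegral_univ] at hlim
  exact ge_of_tendsto' hlim fun n => setIntegral_birkhoffMax_pos_nonneg hT hfm hf n

lemma measurableSet_birkhoffLow (hT : Measurable T) (hf : Measurable f) (a : ℝ) :
    MeasurableSet (birkhoffLow T f a) := by
  have : birkhoffLow T f a = ⋃ r : ℚ, ⋃ _ : (r : ℝ) < a,
      ⋂ N : ℕ, ⋃ n : ℕ, ⋃ _ : N ≤ n, {x | birkhoffSum T f n x < r * n} := by
    ext x
    simp [birkhoffLow, frequently_atTop]
  rw [this]
  refine MeasurableSet.iUnion fun r => MeasurableSet.iUnion fun _ => MeasurableSet.iInter fun N =>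
    MeasurableSet.iUnion fun n => MeasurableSet.iUnion fun _ => ?_
  exact measurableSet_lt (measurable_birkhoffSum hT hf n) measurable_const

lemma setIntegral_le_of_subset_birkhoffLow [IsFiniteMeasure μ] (hT : MeasurePreserving T μ μ)
    (hfm : Measurable f) (hf : Integrable f μ) {a : ℝ} {s : Set α} (hs : MeasurableSet s)
    (hTs : T ⁻¹' s = s) (hsub : s ⊆ birkhoffLow T f a) : ∫ x in s, f x ∂μ ≤ a * μ.real s := by
  have hT' : MeasurePreserving T (μ.restrict s) (μ.restrict s) := by
    simpa only [hTs] using hT.restrict_preimage hs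
  have hfint : Integrable (fun x => a - f x) (μ.restrict s) :=
    (integrable_const a).sub hf.integrableOn
  have key := integral_nonneg_of_exists_birkhoffSum_pos (f := fun x => a - f x) hT' (measurable_const.sub hfm) hfint (by
    filter_upwards [ae_restrict_mem hs] with x hx
    obtain ⟨r, hra, hr⟩ := hsub hx
    obtain ⟨n, hn⟩ := hr.exists
    refine ⟨n, ?_⟩
    have : birkhoffSum T (fun x => a - f x) n x = n * a - birkhoffSum T f n x := by
      simp [birkhoffSum, Finset.sum_sub_distrib]
    rw [this]
    have : (r : ℝ) * n ≤ n * a := by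
      rw [mul_comm]; exact mul_le_mul_of_nonneg_left hra.le (Nat.cast_nonneg n)
    linarith)
  rw [integral_sub (integrable_const a) hf.integrableOn] at key
  simp only [integral_const, smul_eq_mul, measureReal_restrict_apply_univ] at key
  linarith

lemma measure_birkhoffLow_inter_eq_zero [IsFiniteMeasure μ] (hT : MeasurePreserving T μ μ)
    (hfm : Measurable f) (hf : Integrable f μ) {a b : ℝ} (hab : a < b) :
    μ (birkhoffLow T f a ∩ birkhoffLow T (fun y => -f y) (-b)) = 0 := by
  set s := birkhoffLow T f a ∩ birkhoffLow T (fun y => -f y) (-b) with hs_def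
  have hs : MeasurableSet s := (measurableSet_birkhoffLow hT.measurable hfm a).inter
    (measurableSet_birkhoffLow hT.measurable hfm.neg (-b))
  have hTs : T ⁻¹' s = s := by
    rw [hs_def, Set.preimage_inter, preimage_birkhoffLow, preimage_birkhoffLow]
  have h1 := setIntegral_le_of_subset_birkhoffLow hT hfm hf hs hTs Set.inter_subset_left
  have h2 := setIntegral_le_of_subset_birkhoffLow hT hfm.neg hf.neg hs hTs Set.inter_subset_right
  simp only [Pi.neg_apply, integral_neg] at h2
  have h3 : μ.real s = 0 := by
    have := measureReal_nonneg (μ := μ) (s := s)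
    nlinarith
  exact (measureReal_eq_zero_iff).1 h3

lemma ae_exists_notMem_birkhoffLow [IsFiniteMeasure μ] (hT : MeasurePreserving T μ μ)
    (hfm : Measurable f) (hf : Integrable f μ) :
    ∀ᵐ x ∂μ, ∃ N : ℕ, x ∉ birkhoffLow T f (-N) := by
  have hbound : ∀ N : ℕ, N * μ.real (⋂ N : ℕ, birkhoffLow T f (-N)) ≤ ∫ x, |f x| ∂μ := by
    intro N
    have hTs : T ⁻¹' (⋂ N : ℕ, birkhoffLow T f (-N)) = ⋂ N : ℕ, birkhoffLow T f (-N) := by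
      simp only [Set.preimage_iInter, preimage_birkhoffLow]
    have h := setIntegral_le_of_subset_birkhoffLow hT hfm hf
      (MeasurableSet.iInter fun N : ℕ => measurableSet_birkhoffLow hT.measurable hfm (-N)) hTs
      (Set.iInter_subset _ N)
    have h2 : -∫ x in (⋂ N : ℕ, birkhoffLow T f (-N)), f x ∂μ ≤ ∫ x, |f x| ∂μ := by
      refine (neg_le_abs _).trans (abs_integral_le_integral_abs.trans ?_)
      exact setIntegral_le_integral hf.abs (Eventually.of_forall fun x => abs_nonneg _)
    linarith
  have hzero : μ.real (⋂ N : ℕ, birkhoffLow T f (-N)) = 0 := by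
    by_contra hne
    have hpos := lt_of_le_of_ne measureReal_nonneg (Ne.symm hne)
    obtain ⟨N, hN⟩ := exists_nat_gt ((∫ x, |f x| ∂μ) / μ.real (⋂ N : ℕ, birkhoffLow T f (-N)))
    rw [div_lt_iff₀ hpos] at hN
    linarith [hbound N]
  have := (measureReal_eq_zero_iff).1 hzero
  rw [ae_iff]
  convert this using 2
  ext x
  simp

/-- Birkhoff's pointwise ergodic theorem: convergence of the averages almost everywhere. -/
theorem ae_exists_tendsto_birkhoffSum_div [IsFiniteMeasure μ] (hT : MeasurePreserving T μ μ)
    (hfm : Measurable f) (hf : Integrable f μ) :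
    ∀ᵐ x ∂μ, ∃ L : ℝ, Tendsto (fun n : ℕ => birkhoffSum T f n x / n) atTop (𝓝 L) := by
  have hno : ∀ᵐ x ∂μ, ∀ a b : ℚ, a < b →
      x ∉ birkhoffLow T f a ∩ birkhoffLow T (fun y => -f y) (-b) := by
    refine ae_all_iff.2 fun a => ae_all_iff.2 fun b => ?_
    by_cases hab : a < b
    · have := measure_birkhoffLow_inter_eq_zero hT hfm hf (a := a) (b := b) (by exact_mod_cast hab)
      filter_upwards [measure_eq_zero_iff_ae_notMem.1 this] with x hx _ using hx
    · exact Eventually.of_forall fun x h => absurd h hab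
  filter_upwards [hno, ae_exists_notMem_birkhoffLow hT hfm hf,
    ae_exists_notMem_birkhoffLow hT hfm.neg hf.neg] with x hx hlow hhigh
  refine tendsto_of_no_upcrossings Rat.denseRange_cast ?_ ?_ ?_
  · rintro _ ⟨a, rfl⟩ _ ⟨b, rfl⟩ hab ⟨h1, h2⟩
    have hab' : a < b := by exact_mod_cast hab
    obtain ⟨a', ha, ha'⟩ := exists_between hab'
    obtain ⟨b', hb, hb'⟩ := exists_between ha'
    refine hx a' b' hb ⟨mem_birkhoffLow_of_frequently (by exact_mod_cast ha) h1,
      mem_birkhoffLow_of_frequently (r := -b) (by push_cast; exact_mod_cast neg_lt_neg hb') ?_⟩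
    refine h2.mono fun n hn => ?_
    rw [birkhoffSum_neg_apply, neg_div]
    push_cast
    linarith
  · obtain ⟨N, hN⟩ := hhigh
    have := eventually_le_of_notMem_birkhoffLow (r := -N - 1) (by push_cast; linarith) hN
    refine ⟨N + 1, eventually_map.2 ?_⟩
    filter_upwards [this] with n hn
    have h2 : birkhoffSum T (-f) n x = -birkhoffSum T f n x := birkhoffSum_neg_apply n x
    rw [h2, neg_div] at hn
    push_cast at hn
    linarith
  · obtain ⟨N, hN⟩ := hlow
    have := eventually_le_of_notMem_birkhoffLow (r := -N - 1) (by push_cast; linarith) hN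
    exact ⟨_, eventually_map.2 this⟩

end Birkhoff

section GaussMeasure

lemma gaussMap_eq_fract (x : ℝ) : gaussMap x = Int.fract (1 / x) := by
  unfold gaussMap
  split_ifs with h
  · simp [h]
  · rfl

lemma measurable_gaussMap : Measurable gaussMap := by
  have : gaussMap = fun x => Int.fract (1 / x) := funext gaussMap_eq_fract
  rw [this]
  exact measurable_fract.comp (measurable_const.div measurable_id)

/-- The (unnormalised) Gauss measure, with density `1 / (1 + x)` on `(0, 1]`. -/
noncomputable def gaussMeasure : Measure ℝ :=
  (volume.restrict (Set.Ioc 0 1)).withDensity fun x => ENNReal.ofReal (1 + x)⁻¹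

lemma measurable_gaussDensity : Measurable fun x : ℝ => ENNReal.ofReal (1 + x)⁻¹ :=
  (measurable_const.add measurable_id).inv.ennreal_ofReal

lemma gaussMeasure_apply_eq_Ioc {s : Set ℝ} (hs : MeasurableSet s) {c d : ℝ} (hc : 0 ≤ c)
    (hcd : c ≤ d) (h : (s ∩ Set.Ioc 0 1 : Set ℝ) =ᵐ[volume] Set.Ioc c d) :
    gaussMeasure s = ENNReal.ofReal (Real.log (1 + d) - Real.log (1 + c)) := by
  have hpos : ∀ x ∈ Set.uIcc c d, 0 < 1 + x := fun x hx => by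
    rw [Set.uIcc_of_le hcd] at hx
    linarith [hx.1]
  have hcont : ContinuousOn (fun x : ℝ => (1 + x)⁻¹) (Set.uIcc c d) :=
    (continuousOn_const.add continuousOn_id).inv₀ fun x hx => (hpos x hx).ne'
  have hfint : IntervalIntegrable (fun x : ℝ => (1 + x)⁻¹) volume c d := hcont.intervalIntegrable
  have hval : ∫ x in c..d, (1 + x)⁻¹ = Real.log (1 + d) - Real.log (1 + c) := by
    refine intervalIntegral.integral_eq_sub_of_hasDerivAt (f := fun x => Real.log (1 + x))
      (fun x hx => ?_) hfint
    simpa using ((hasDerivAt_id x).const_add 1).log (hpos x hx).ne'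
  rw [gaussMeasure, withDensity_apply _ hs, Measure.restrict_restrict hs, setLIntegral_congr h,
    ← hval, intervalIntegral.integral_of_le hcd,
    ofReal_integral_eq_lintegral_ofReal ((intervalIntegrable_iff_integrableOn_Ioc_of_le hcd).1 hfint)]
  filter_upwards [ae_restrict_mem measurableSet_Ioc] with x hx
  exact inv_nonneg.2 (by linarith [hx.1])

instance isFiniteMeasure_gaussMeasure : IsFiniteMeasure gaussMeasure := by
  refine ⟨?_⟩
  rw [gaussMeasure_apply_eq_Ioc MeasurableSet.univ le_rfl zero_le_one
    (by rw [Set.univ_inter]; exact EventuallyEq.rfl)]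
  exact ENNReal.ofReal_lt_top

lemma gaussMeasure_Ioc_compl : gaussMeasure (Set.Ioc 0 1)ᶜ = 0 := by
  rw [gaussMeasure, withDensity_apply _ measurableSet_Ioc.compl,
    Measure.restrict_restrict measurableSet_Ioc.compl]
  simp

lemma preimage_gaussMap_Iic_inter {a : ℝ} (ha : 0 ≤ a) (ha1 : a < 1) :
    gaussMap ⁻¹' Set.Iic a ∩ Set.Ioc 0 1 =
      ⋃ n : ℕ, Set.Icc (1 / (n + 1 + a)) (1 / (n + 1) : ℝ) := by
  ext x
  simp only [Set.mem_inter_iff, Set.mem_preimage, Set.mem_Iic, Set.mem_Ioc, Set.mem_iUnion,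
    Set.mem_Icc, gaussMap_eq_fract]
  constructor
  · rintro ⟨h, h0, h1⟩
    have h2 : 1 ≤ 1 / x := by rw [le_div_iff₀ h0]; linarith
    have h3 : 1 ≤ ⌊1 / x⌋₊ := Nat.le_floor (by simpa using h2)
    have h4 := Nat.floor_le (zero_le_one.trans h2)
    have h5 : 1 / x ≤ ⌊1 / x⌋₊ + a := by
      rw [Int.fract, ← natCast_floor_eq_intCast_floor (zero_le_one.trans h2)] at h
      linarith
    refine ⟨⌊1 / x⌋₊ - 1, ?_, ?_⟩
    · push_cast [h3]
      rw [sub_add_cancel, one_div_le (by positivity) h0]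
      exact h5
    · push_cast [h3]
      rw [sub_add_cancel, le_one_div h0 (by exact_mod_cast h3)]
      exact h4
  · rintro ⟨n, h1, h2⟩
    have h0 : 0 < x := lt_of_lt_of_le (by positivity) h1
    rw [one_div_le (by positivity) h0] at h1
    have h3 : (n + 1 : ℝ) ≤ 1 / x := by rwa [le_one_div (by positivity) h0]
    have h4 : ⌊1 / x⌋ = (n + 1 : ℤ) := by
      rw [Int.floor_eq_iff]
      push_cast
      exact ⟨h3, by linarith⟩
    refine ⟨?_, h0, h2.trans ?_⟩
    · rw [Int.fract, h4]
      push_cast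
      linarith
    · rw [div_le_one (by positivity)]
      linarith [(Nat.cast_nonneg n : (0 : ℝ) ≤ n)]

lemma gaussBranch_endpoint_le {a : ℝ} (ha : 0 ≤ a) (n : ℕ) :
    (1 / (n + 1 + a) : ℝ) ≤ 1 / (n + 1) :=
  one_div_le_one_div_of_le (by positivity) (by linarith)

lemma pairwise_disjoint_gaussBranch {a : ℝ} (ha : 0 ≤ a) (ha1 : a < 1) :
    Pairwise (Function.onFun Disjoint
      fun n : ℕ => Set.Icc (1 / (n + 1 + a)) (1 / (n + 1) : ℝ)) := by
  refine (pairwise_disjoint_on _).2 fun m n hmn => Set.disjoint_left.2 fun x hx hx' => ?_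
  have hmn' : (m + 1 : ℝ) ≤ n := by exact_mod_cast hmn
  have hm : (0 : ℝ) ≤ m := Nat.cast_nonneg m
  have h := hx.1.trans hx'.2
  rw [one_div_le_one_div (by positivity) (by positivity)] at h
  linarith

lemma hasSum_log_gaussBranch {a : ℝ} (ha : 0 ≤ a) :
    HasSum (fun n : ℕ => Real.log (1 + 1 / (n + 1)) - Real.log (1 + 1 / (n + 1 + a)))
      (Real.log (1 + a)) := by
  have hterm : ∀ n : ℕ, Real.log (1 + 1 / (n + 1)) - Real.log (1 + 1 / (n + 1 + a)) =
      Real.log (1 + a / (n + 1)) - Real.log (1 + a / ((n + 1 : ℕ) + 1)) := by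
    intro n
    have h1 : (0 : ℝ) < n + 1 := by positivity
    have h2 : (0 : ℝ) < n + 1 + a := by positivity
    have h3 : (0 : ℝ) < n + 1 + 1 := by positivity
    have h4 : (0 : ℝ) < n + 1 + 1 + a := by positivity
    have e1 : (1 : ℝ) + 1 / (n + 1) = (n + 1 + 1) / (n + 1) := by field_simp
    have e2 : (1 : ℝ) + 1 / (n + 1 + a) = (n + 1 + 1 + a) / (n + 1 + a) := by
      field_simp
      ring
    have e3 : 1 + a / ((n : ℝ) + 1) = (n + 1 + a) / (n + 1) := by field_simp
    have e4 : 1 + a / (((n + 1 : ℕ) : ℝ) + 1) = (n + 1 + 1 + a) / (n + 1 + 1) := by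
      push_cast
      field_simp
    rw [e1, e2, e3, e4, Real.log_div h3.ne' h1.ne', Real.log_div h4.ne' h2.ne',
      Real.log_div h2.ne' h1.ne', Real.log_div h4.ne' h3.ne']
    ring
  have hlim : Tendsto (fun n : ℕ => Real.log (1 + a / (n + 1))) atTop (𝓝 0) := by
    have h1 : Tendsto (fun n : ℕ => a / ((n : ℝ) + 1)) atTop (𝓝 0) :=
      tendsto_const_nhds.div_atTop (tendsto_atTop_add_const_right _ _ tendsto_natCast_atTop_atTop)
    have h2 := (h1.const_add 1).log (by norm_num)
    simpa using h2
  rw [hasSum_iff_tendsto_nat_of_nonneg]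
  · simp only [hterm]
    simp_rw [Finset.sum_range_sub' (fun n : ℕ => Real.log (1 + a / ((n : ℝ) + 1)))]
    simpa using hlim.const_sub (Real.log (1 + a))
  · intro n
    refine sub_nonneg.2 (Real.log_le_log (by positivity) ?_)
    linarith [gaussBranch_endpoint_le ha n]

lemma gaussMeasure_preimage_Iic {a : ℝ} (ha : 0 ≤ a) (ha1 : a < 1) :
    gaussMeasure (gaussMap ⁻¹' Set.Iic a) = gaussMeasure (Set.Iic a) := by
  have hI : gaussMeasure (Set.Iic a) = ENNReal.ofReal (Real.log (1 + a)) := by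
    rw [gaussMeasure_apply_eq_Ioc measurableSet_Iic le_rfl ha]
    · simp
    · have : Set.Iic a ∩ Set.Ioc 0 1 = Set.Ioc 0 a := by
        ext x
        simp only [Set.mem_inter_iff, Set.mem_Iic, Set.mem_Ioc]
        constructor
        · rintro ⟨h1, h2, h3⟩
          exact ⟨h2, h1⟩
        · rintro ⟨h1, h2⟩
          exact ⟨h2, h1, by linarith⟩
      rw [this]
      exact EventuallyEq.rfl
  have hbranch : ∀ n : ℕ, gaussMeasure (Set.Icc (1 / (n + 1 + a)) (1 / (n + 1) : ℝ)) =
      ENNReal.ofReal (Real.log (1 + 1 / (n + 1)) - Real.log (1 + 1 / (n + 1 + a))) := by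
    intro n
    refine gaussMeasure_apply_eq_Ioc measurableSet_Icc (by positivity) ?_ ?_
    · exact gaussBranch_endpoint_le ha n
    · rw [Set.inter_eq_left.2]
      · exact Ioc_ae_eq_Icc.symm
      · intro x hx
        refine ⟨lt_of_lt_of_le (by positivity) hx.1, hx.2.trans ?_⟩
        rw [div_le_one (by positivity)]
        linarith [(Nat.cast_nonneg n : (0 : ℝ) ≤ n)]
  rw [← Measure.measure_inter_eq_of_ae (s := gaussMap ⁻¹' Set.Iic a) (t := Set.Ioc 0 1)
    (mem_ae_iff.2 gaussMeasure_Ioc_compl), Set.inter_comm, preimage_gaussMap_Iic_inter ha ha1,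
    measure_iUnion (pairwise_disjoint_gaussBranch ha ha1) fun n => measurableSet_Icc]
  simp_rw [hbranch]
  rw [hI, ← (hasSum_log_gaussBranch ha).tsum_eq, ENNReal.ofReal_tsum_of_nonneg]
  · intro n
    refine sub_nonneg.2 (Real.log_le_log (by positivity) ?_)
    linarith [gaussBranch_endpoint_le ha n]
  · exact (hasSum_log_gaussBranch ha).summable

/-- The Gauss map preserves the Gauss measure. -/
theorem measurePreserving_gaussMap : MeasurePreserving gaussMap gaussMeasure gaussMeasure := by
  refine ⟨measurable_gaussMap, ?_⟩
  have : IsFiniteMeasure (gaussMeasure.map gaussMap) := inferInstance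
  refine Measure.ext_of_Iic _ _ fun a => ?_
  rw [Measure.map_apply measurable_gaussMap measurableSet_Iic]
  rcases lt_or_ge a 0 with ha | ha
  · have h1 : gaussMap ⁻¹' Set.Iic a = ∅ := by
      ext x
      simp only [Set.mem_preimage, Set.mem_Iic, Set.mem_empty_iff_false, iff_false, not_le,
        gaussMap_eq_fract]
      exact ha.trans_le (Int.fract_nonneg _)
    rw [h1, measure_empty]
    refine (measure_mono_null (fun x hx => ?_) gaussMeasure_Ioc_compl).symm
    exact fun h => absurd (h.1.trans_le hx) (not_lt.2 ha.le)
  rcases lt_or_ge a 1 with ha1 | ha1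
  · exact gaussMeasure_preimage_Iic ha ha1
  · have h1 : gaussMap ⁻¹' Set.Iic a = Set.univ := by
      ext x
      simp only [Set.mem_preimage, Set.mem_Iic, Set.mem_univ, iff_true, gaussMap_eq_fract]
      exact (Int.fract_lt_one _).le.trans ha1
    rw [h1]
    refine (measure_congr (eventuallyEq_univ.2 ?_)).symm
    filter_upwards [mem_ae_iff.2 gaussMeasure_Ioc_compl] with x hx
    exact hx.2.trans ha1

lemma volume_restrict_absolutelyContinuous_gaussMeasure :
    volume.restrict (Set.Ioc 0 1) ≪ gaussMeasure := by
  refine withDensity_absolutelyContinuous' measurable_gaussDensity.aemeasurable ?_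
  filter_upwards [ae_restrict_mem measurableSet_Ioc] with x hx
  rw [Ne, ENNReal.ofReal_eq_zero, not_le]
  exact inv_pos.2 (by linarith [hx.1])

lemma gaussMeasure_le_volume : gaussMeasure ≤ volume.restrict (Set.Ioc 0 1) := by
  refine (withDensity_mono (g := fun _ => 1) ?_).trans_eq (withDensity_one)
  filter_upwards [ae_restrict_mem measurableSet_Ioc] with x hx
  rw [ENNReal.ofReal_le_one]
  exact inv_le_one_of_one_le₀ (by linarith [hx.1])

lemma integrable_neg_log_gaussMeasure : Integrable (fun x => -Real.log x) gaussMeasure := by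
  refine Integrable.mono_measure ?_ gaussMeasure_le_volume
  exact ((intervalIntegrable_iff_integrableOn_Ioc_of_le zero_le_one).1
    intervalIntegral.intervalIntegrable_log').neg

/-- Almost everywhere convergence of the Birkhoff averages of `-log` for the Gauss map. -/
lemma ae_exists_tendsto_birkhoffSum_neg_log :
    ∀ᵐ x ∂(volume.restrict (Set.Ioc (0 : ℝ) 1)), ∃ L : ℝ, Tendsto
      (fun n : ℕ => birkhoffSum gaussMap (fun y => -Real.log y) n x / n) atTop (𝓝 L) :=
  volume_restrict_absolutelyContinuous_gaussMeasure.ae_le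
    (ae_exists_tendsto_birkhoffSum_div measurePreserving_gaussMap Real.measurable_log.neg
      integrable_neg_log_gaussMeasure)

end GaussMeasure

section ContinuedFraction

/-- The irrational numbers of the open unit interval. -/
def unitIrrationals : Set ℝ := {x | x ∈ Set.Ioo (0 : ℝ) 1 ∧ Irrational x}

lemma gaussMap_mem_unitIrrationals {x : ℝ} (hx : x ∈ unitIrrationals) :
    gaussMap x ∈ unitIrrationals := by
  have hirr : Irrational (gaussMap x) := by
    rw [gaussMap_eq_fract, one_div, Int.fract]
    exact (irrational_inv_iff.2 hx.2).sub_intCast _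
  have h0 : 0 ≤ gaussMap x := by rw [gaussMap_eq_fract]; exact Int.fract_nonneg _
  have h1 : gaussMap x < 1 := by rw [gaussMap_eq_fract]; exact Int.fract_lt_one _
  exact ⟨⟨lt_of_le_of_ne h0 fun h => hirr.ne_zero h.symm, h1⟩, hirr⟩

variable {x y : ℝ}

lemma iterate_gaussMap_mem (hx : x ∈ unitIrrationals) (n : ℕ) :
    gaussMap^[n] x ∈ unitIrrationals := by
  induction n with
  | zero => exact hx
  | succ n ih =>
    rw [Function.iterate_succ_apply']
    exact gaussMap_mem_unitIrrationals ih

lemma iterate_gaussMap_pos (hx : x ∈ unitIrrationals) (n : ℕ) : 0 < gaussMap^[n] x :=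
  (iterate_gaussMap_mem hx n).1.1

lemma iterate_gaussMap_lt_one (hx : x ∈ unitIrrationals) (n : ℕ) : gaussMap^[n] x < 1 :=
  (iterate_gaussMap_mem hx n).1.2

lemma iterate_gaussMap_mul (hx : x ∈ unitIrrationals) (n : ℕ) :
    gaussMap^[n] x * (digit x (n + 1) + gaussMap^[n + 1] x) = 1 := by
  have h := (iterate_gaussMap_pos hx n).ne'
  have h2 : gaussMap^[n + 1] x = 1 / gaussMap^[n] x - digit x (n + 1) := by
    rw [Function.iterate_succ_apply', gaussMap, if_neg h, digit, Nat.add_sub_cancel]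
  rw [h2, add_sub_cancel, mul_one_div_cancel h]

lemma one_le_digit (hx : x ∈ unitIrrationals) (n : ℕ) : 1 ≤ digit x (n + 1) := by
  rw [digit, Nat.add_sub_cancel]
  refine Int.le_floor.2 ?_
  rw [Int.cast_one, le_div_iff₀ (iterate_gaussMap_pos hx n), one_mul]
  exact (iterate_gaussMap_lt_one hx n).le

lemma one_le_digit_cast (hx : x ∈ unitIrrationals) (n : ℕ) : (1 : ℝ) ≤ digit x (n + 1) := by
  exact_mod_cast one_le_digit hx n

/-- The product of the first `n` points of the orbit of `x` under the Gauss map. -/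
noncomputable def orbitProd (x : ℝ) (n : ℕ) : ℝ := ∏ k ∈ Finset.range n, gaussMap^[k] x

lemma orbitProd_succ (x : ℝ) (n : ℕ) :
    orbitProd x (n + 1) = orbitProd x n * gaussMap^[n] x :=
  Finset.prod_range_succ _ _

lemma orbitProd_pos (hx : x ∈ unitIrrationals) (n : ℕ) : 0 < orbitProd x n :=
  Finset.prod_pos fun k _ => iterate_gaussMap_pos hx k

lemma qq_nonneg_and_le {a : ℕ → ℤ} (ha : ∀ n, 1 ≤ a (n + 1)) (n : ℕ) :
    0 ≤ qq a n ∧ qq a n ≤ qq a (n + 1) := by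
  induction n with
  | zero => simp [qq]
  | succ n ih =>
    have h : 0 ≤ qq a (n + 1) := ih.1.trans ih.2
    refine ⟨h, ?_⟩
    rw [qq]
    nlinarith [ha n, ih.1]

lemma one_le_qq {a : ℕ → ℤ} (ha : ∀ n, 1 ≤ a (n + 1)) (n : ℕ) : 1 ≤ qq a (n + 1) := by
  induction n with
  | zero => simp [qq]
  | succ n ih => exact ih.trans (qq_nonneg_and_le ha (n + 1)).2

lemma one_le_qDen (hx : x ∈ unitIrrationals) (n : ℕ) : (1 : ℝ) ≤ qDen x (n + 1) := by
  exact_mod_cast one_le_qq (one_le_digit hx) n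

lemma qDen_mul_orbitProd (hx : x ∈ unitIrrationals) (n : ℕ) :
    (qDen x (n + 1) + qDen x n * gaussMap^[n] x) * orbitProd x n = 1 := by
  induction n with
  | zero => simp [qDen, qq, orbitProd]
  | succ n ih =>
    have h : (qDen x (n + 2) : ℝ) = digit x (n + 1) * qDen x (n + 1) + qDen x n := by
      simp [qDen, qq]
    rw [orbitProd_succ, h, ← ih]
    linear_combination (qDen x (n + 1) * orbitProd x n : ℝ) * iterate_gaussMap_mul hx n

lemma qDen_mul_orbitProd_le_one (hx : x ∈ unitIrrationals) (n : ℕ) :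
    qDen x (n + 1) * orbitProd x n ≤ 1 := by
  have h1 : (0 : ℝ) ≤ qDen x n := by exact_mod_cast (qq_nonneg_and_le (one_le_digit hx) n).1
  rw [← qDen_mul_orbitProd hx n]
  refine mul_le_mul_of_nonneg_right ?_ (orbitProd_pos hx n).le
  linarith [mul_nonneg h1 (iterate_gaussMap_pos hx n).le]

lemma one_le_two_mul_qDen_mul_orbitProd (hx : x ∈ unitIrrationals) (n : ℕ) :
    1 ≤ 2 * qDen x (n + 1) * orbitProd x n := by
  have h1 : (0 : ℝ) ≤ qDen x n := by exact_mod_cast (qq_nonneg_and_le (one_le_digit hx) n).1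
  have h2 : (qDen x n : ℝ) ≤ qDen x (n + 1) := by
    exact_mod_cast (qq_nonneg_and_le (one_le_digit hx) n).2
  conv_lhs => rw [← qDen_mul_orbitProd hx n]
  refine mul_le_mul_of_nonneg_right ?_ (orbitProd_pos hx n).le
  nlinarith [iterate_gaussMap_pos hx n, iterate_gaussMap_lt_one hx n]

lemma orbitProd_mul_succ_le (hx : x ∈ unitIrrationals) (n : ℕ) :
    orbitProd x n * orbitProd x (n + 1) ≤ (1 / 2) ^ n := by
  induction n with
  | zero => simpa [orbitProd] using hx.1.2.le
  | succ n ih =>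
    have h : gaussMap^[n] x * gaussMap^[n + 1] x ≤ 1 / 2 := by
      have h1 := iterate_gaussMap_mul hx n
      have h2 := one_le_digit_cast hx n
      have h3 := iterate_gaussMap_pos hx n
      have h4 := iterate_gaussMap_lt_one hx (n + 1)
      nlinarith
    have hp := mul_pos (iterate_gaussMap_pos hx n) (iterate_gaussMap_pos hx (n + 1))
    calc orbitProd x (n + 1) * orbitProd x (n + 1 + 1)
        = (orbitProd x n * orbitProd x (n + 1)) * (gaussMap^[n] x * gaussMap^[n + 1] x) := by
          rw [orbitProd_succ x (n + 1), orbitProd_succ x n]; ring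
      _ ≤ (1 / 2) ^ n * (1 / 2) := mul_le_mul ih h hp.le (by positivity)
      _ = (1 / 2) ^ (n + 1) := (pow_succ _ _).symm

lemma orbitProd_sq_le (hx : x ∈ unitIrrationals) (n : ℕ) :
    orbitProd x n ^ 2 ≤ 2 * (1 / 2) ^ n := by
  cases n with
  | zero => simp [orbitProd]
  | succ n =>
    have h1 := orbitProd_mul_succ_le hx n
    have h2 : orbitProd x (n + 1) ≤ orbitProd x n := by
      rw [orbitProd_succ]
      exact mul_le_of_le_one_right (orbitProd_pos hx n).le (iterate_gaussMap_lt_one hx n).le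
    rw [pow_succ (1 / 2 : ℝ) n]
    nlinarith [orbitProd_pos hx (n + 1)]

lemma orbitProd_mul_orbitProd_le (hx : x ∈ unitIrrationals) (hy : y ∈ unitIrrationals) (n : ℕ) :
    orbitProd x n * orbitProd y n ≤ 2 * (1 / 2) ^ n := by
  nlinarith [orbitProd_sq_le hx n, orbitProd_sq_le hy n,
    sq_nonneg (orbitProd x n - orbitProd y n)]

/-- The distance between two points with the same first `m` digits. -/
lemma abs_sub_eq_of_digit_eq (hx : x ∈ unitIrrationals) (hy : y ∈ unitIrrationals) (m : ℕ)
    (h : ∀ k < m, digit x (k + 1) = digit y (k + 1)) :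
    |x - y| = orbitProd x m * orbitProd y m * |gaussMap^[m] x - gaussMap^[m] y| := by
  induction m with
  | zero => simp [orbitProd]
  | succ m ih =>
    rw [ih fun k hk => h k (hk.trans m.lt_succ_self), orbitProd_succ, orbitProd_succ]
    have h1 := iterate_gaussMap_mul hx m
    have h2 := iterate_gaussMap_mul hy m
    rw [h m m.lt_succ_self] at h1
    have h3 : gaussMap^[m] x - gaussMap^[m] y =
        -(gaussMap^[m] x * gaussMap^[m] y * (gaussMap^[m + 1] x - gaussMap^[m + 1] y)) := by
      linear_combination gaussMap^[m] y * h1 - gaussMap^[m] x * h2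
    rw [h3, abs_neg, abs_mul, abs_of_pos
      (mul_pos (iterate_gaussMap_pos hx m) (iterate_gaussMap_pos hy m))]
    ring

lemma abs_sub_le_of_digit_eq (hx : x ∈ unitIrrationals) (hy : y ∈ unitIrrationals) (m : ℕ)
    (h : ∀ k < m, digit x (k + 1) = digit y (k + 1)) :
    |x - y| ≤ orbitProd x m * orbitProd y m := by
  rw [abs_sub_eq_of_digit_eq hx hy m h]
  refine mul_le_of_le_one_right (mul_pos (orbitProd_pos hx m) (orbitProd_pos hy m)).le ?_
  rw [abs_le]
  constructor <;> linarith [iterate_gaussMap_pos hx m, iterate_gaussMap_pos hy m,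
    iterate_gaussMap_lt_one hx m, iterate_gaussMap_lt_one hy m]

lemma exists_first_digit_ne (hx : x ∈ unitIrrationals) (hy : y ∈ unitIrrationals) (hxy : x ≠ y) :
    ∃ m, (∀ k < m, digit x (k + 1) = digit y (k + 1)) ∧ digit x (m + 1) ≠ digit y (m + 1) := by
  classical
  have hex : ∃ m, digit x (m + 1) ≠ digit y (m + 1) := by
    by_contra! h
    have hlim : Tendsto (fun n : ℕ => 2 * (1 / 2 : ℝ) ^ n) atTop (𝓝 0) := by
      simpa using (tendsto_pow_atTop_nhds_zero_of_lt_one (r := (1 / 2 : ℝ)) (by norm_num)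
        (by norm_num)).const_mul 2
    have := ge_of_tendsto' hlim fun n =>
      (abs_sub_le_of_digit_eq hx hy n fun k _ => h k).trans (orbitProd_mul_orbitProd_le hx hy n)
    exact hxy (sub_eq_zero.1 (abs_eq_zero.1 (le_antisymm this (abs_nonneg _))))
  exact ⟨Nat.find hex, fun k hk => not_not.1 (Nat.find_min hex hk), Nat.find_spec hex⟩

lemma iterate_mul_succ_le_one_sub (hx : x ∈ unitIrrationals) (n : ℕ) :
    gaussMap^[n] x * gaussMap^[n + 1] x ≤ 1 - gaussMap^[n] x := by
  nlinarith [iterate_gaussMap_mul hx n, one_le_digit_cast hx n, iterate_gaussMap_pos hx n]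

/-- Points whose first digits differ after `m` steps are separated. -/
lemma le_abs_sub_of_digit_ne (hx : x ∈ unitIrrationals) (hy : y ∈ unitIrrationals) (m : ℕ)
    (h : digit x (m + 1) ≠ digit y (m + 1)) :
    gaussMap^[m] x * gaussMap^[m] y * ((gaussMap^[m + 1] x * gaussMap^[m + 2] x) *
      (gaussMap^[m + 1] y * gaussMap^[m + 2] y)) ≤ |gaussMap^[m] x - gaussMap^[m] y| := by
  wlog hlt : digit x (m + 1) < digit y (m + 1) generalizing x y
  · have := this hy hx h.symm (lt_of_le_of_ne (not_lt.1 hlt) h.symm)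
    rw [abs_sub_comm]
    linarith
  have hlt' : (digit x (m + 1) : ℝ) + 1 ≤ digit y (m + 1) := by exact_mod_cast hlt
  have h3 : gaussMap^[m] x - gaussMap^[m] y = gaussMap^[m] x * gaussMap^[m] y *
      (digit y (m + 1) + gaussMap^[m + 1] y - (digit x (m + 1) + gaussMap^[m + 1] x)) := by
    linear_combination gaussMap^[m] y * iterate_gaussMap_mul hx m -
      gaussMap^[m] x * iterate_gaussMap_mul hy m
  refine le_trans ?_ (le_abs_self _)
  rw [h3]
  refine mul_le_mul_of_nonneg_left ?_
    (mul_pos (iterate_gaussMap_pos hx m) (iterate_gaussMap_pos hy m)).le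
  have h4 := iterate_mul_succ_le_one_sub hx (m + 1)
  have h5 : gaussMap^[m + 1] y * gaussMap^[m + 2] y ≤ 1 :=
    mul_le_one₀ (iterate_gaussMap_lt_one hy _).le (iterate_gaussMap_pos hy _).le
      (iterate_gaussMap_lt_one hy _).le
  have h6 := mul_pos (iterate_gaussMap_pos hx (m + 1)) (iterate_gaussMap_pos hx (m + 2))
  have h7 := mul_le_of_le_one_right h6.le h5
  have h8 : gaussMap^[m + 1 + 1] x = gaussMap^[m + 2] x := rfl
  rw [h8] at h4
  linarith [iterate_gaussMap_pos hy (m + 1)]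

lemma exists_orbit_prefix (n : ℕ) (a : ℕ → ℤ) (ha : ∀ i, 1 ≤ a i) :
    ∃ z : ℕ → ℝ, (∀ i, z i ∈ Set.Icc (0 : ℝ) 1) ∧ ∀ i < n, z i * (a i + z (i + 1)) = 1 := by
  induction n generalizing a with
  | zero => exact ⟨fun _ => 0, fun i => by simp, fun i hi => absurd hi (Nat.not_lt_zero i)⟩
  | succ n ih =>
    obtain ⟨z, hz, hz'⟩ := ih (fun i => a (i + 1)) fun i => ha (i + 1)
    have h0 : (1 : ℝ) ≤ a 0 := by exact_mod_cast ha 0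
    have h1 : (1 : ℝ) ≤ a 0 + z 0 := by linarith [(hz 0).1]
    refine ⟨fun i => Nat.casesOn i (1 / (a 0 + z 0)) z, fun i => ?_, fun i hi => ?_⟩
    · cases i with
      | zero => exact ⟨(one_div_pos.2 (by linarith)).le, (div_le_one (by linarith)).2 h1⟩
      | succ i => exact hz i
    · cases i with
      | zero => exact one_div_mul_cancel (by linarith)
      | succ i => exact hz' i (by omega)

lemma exists_orbit (a : ℕ → ℤ) (ha : ∀ i, 1 ≤ a i) :
    ∃ z : ℕ → ℝ, (∀ i, z i ∈ Set.Icc (0 : ℝ) 1) ∧ ∀ i, z i * (a i + z (i + 1)) = 1 := by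
  have hne := IsCompact.nonempty_iInter_of_sequence_nonempty_isCompact_isClosed
    (fun n => Set.pi Set.univ (fun _ : ℕ => Set.Icc (0 : ℝ) 1) ∩
      {z : ℕ → ℝ | ∀ i < n, z i * (a i + z (i + 1)) = 1}) ?_ ?_ ?_ ?_
  · obtain ⟨z, hz⟩ := hne
    rw [Set.mem_iInter] at hz
    exact ⟨z, fun i => (hz 0).1 i trivial, fun i => (hz (i + 1)).2 i i.lt_succ_self⟩
  · exact fun n z hz => ⟨hz.1, fun i hi => hz.2 i (hi.trans n.lt_succ_self)⟩
  · intro n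
    obtain ⟨z, hz, hz'⟩ := exists_orbit_prefix n a ha
    exact ⟨z, fun i _ => hz i, hz'⟩
  · simpa using isCompact_univ_pi fun _ : ℕ => isCompact_Icc
  · intro n
    refine (isClosed_set_pi fun _ _ => isClosed_Icc).inter ?_
    simp only [Set.ofPred_forall]
    exact isClosed_iInter fun i => isClosed_iInter fun _ =>
      isClosed_eq (by fun_prop) continuous_const

lemma not_rational_of_orbit (q : ℕ) (a : ℕ → ℤ) (z : ℕ → ℝ) (hz : ∀ i, z i ∈ Set.Ioo (0 : ℝ) 1)
    (hz' : ∀ i, z i * (a i + z (i + 1)) = 1) (hq : 0 < q) (p : ℤ) : z 0 * q ≠ p := by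
  induction q using Nat.strong_induction_on generalizing a z p with
  | _ q ih =>
    intro hp
    have hq' : (0 : ℝ) < q := by exact_mod_cast hq
    have hp0 : 0 < p := by
      have : (0 : ℝ) < p := hp ▸ mul_pos (hz 0).1 hq'
      exact_mod_cast this
    have hpq : p < q := by
      have : (p : ℝ) < q := by rw [← hp]; exact mul_lt_of_lt_one_left hq' (hz 0).2
      exact_mod_cast this
    lift p to ℕ using hp0.le
    refine ih p (by exact_mod_cast hpq) (fun i => a (i + 1)) (fun i => z (i + 1))
      (fun i => hz (i + 1)) (fun i => hz' (i + 1)) (by exact_mod_cast hp0) (q - a 0 * p) ?_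
    push_cast at hp ⊢
    linear_combination (q : ℝ) * hz' 0 - (a 0 + z 1) * hp

/-- Every sequence of positive integers is the digit sequence of an irrational number. -/
theorem exists_digit_eq (a : ℕ → ℤ) (ha : ∀ i, 1 ≤ a i) :
    ∃ x ∈ unitIrrationals, ∀ n, digit x (n + 1) = a n := by
  obtain ⟨z, hz, hz'⟩ := exists_orbit a ha
  have ha' : ∀ i, (1 : ℝ) ≤ a i := fun i => by exact_mod_cast ha i
  have hpos : ∀ i, 0 < z i := fun i => lt_of_le_of_ne (hz i).1 fun h => by
    have := hz' i
    rw [← h, zero_mul] at this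
    exact zero_ne_one this
  have hlt : ∀ i, z i < 1 := fun i => by nlinarith [hz' i, ha' i, hpos i, hpos (i + 1)]
  have hinv : ∀ i, 1 / z i = a i + z (i + 1) := fun i => by
    rw [div_eq_iff (hpos i).ne']
    linarith [hz' i]
  have hfloor : ∀ i, ⌊1 / z i⌋ = a i := fun i => by
    rw [Int.floor_eq_iff, hinv]
    exact ⟨by linarith [hpos (i + 1)], by linarith [hlt (i + 1)]⟩
  have hT : ∀ i, gaussMap (z i) = z (i + 1) := fun i => by
    rw [gaussMap_eq_fract, Int.fract, hfloor, hinv]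
    ring
  have hiter : ∀ n, gaussMap^[n] (z 0) = z n := fun n => by
    induction n with
    | zero => rfl
    | succ n ih => rw [Function.iterate_succ_apply', ih, hT]
  refine ⟨z 0, ⟨⟨hpos 0, hlt 0⟩, ?_⟩, fun n => ?_⟩
  · rintro ⟨r, hr⟩
    refine not_rational_of_orbit r.den a z (fun i => ⟨hpos i, hlt i⟩) hz' r.den_pos r.num ?_
    rw [← hr]
    exact_mod_cast Rat.mul_den_eq_num r
  · rw [digit, Nat.add_sub_cancel, hiter, hfloor]

end ContinuedFraction

section NullSet

variable {x : ℝ}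

lemma birkhoffSum_neg_log (hx : x ∈ unitIrrationals) (n : ℕ) :
    birkhoffSum gaussMap (fun y => -Real.log y) n x = -Real.log (orbitProd x n) := by
  rw [orbitProd, Real.log_prod fun k _ => (iterate_gaussMap_pos hx k).ne', birkhoffSum,
    Finset.sum_neg_distrib]

lemma abs_log_qDen_sub_birkhoffSum_le (hx : x ∈ unitIrrationals) (n : ℕ) :
    |Real.log (qDen x (n + 1)) - birkhoffSum gaussMap (fun y => -Real.log y) n x| ≤
      Real.log 2 := by
  have hq : (0 : ℝ) < qDen x (n + 1) := zero_lt_one.trans_le (one_le_qDen hx n)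
  have hp := orbitProd_pos hx n
  have h1 := Real.log_nonneg (one_le_two_mul_qDen_mul_orbitProd hx n)
  have h2 := Real.log_nonpos (mul_pos hq hp).le (qDen_mul_orbitProd_le_one hx n)
  rw [mul_assoc, Real.log_mul two_ne_zero (mul_pos hq hp).ne', Real.log_mul hq.ne' hp.ne'] at h1
  rw [Real.log_mul hq.ne' hp.ne'] at h2
  rw [birkhoffSum_neg_log hx, abs_le]
  constructor <;> linarith [Real.log_nonneg one_le_two]

lemma tendsto_log_qDen_div (hx : x ∈ unitIrrationals) {L : ℝ} (h : Tendsto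
    (fun n : ℕ => birkhoffSum gaussMap (fun y => -Real.log y) n x / n) atTop (𝓝 L)) :
    Tendsto (fun n : ℕ => Real.log (qDen x (n + 1)) / n) atTop (𝓝 L) := by
  have h0 : Tendsto (fun n : ℕ => (Real.log (qDen x (n + 1)) -
      birkhoffSum gaussMap (fun y => -Real.log y) n x) / n) atTop (𝓝 0) := by
    refine squeeze_zero_norm (fun n => ?_) (tendsto_const_div_atTop_nhds_zero_nat (Real.log 2))
    rw [Real.norm_eq_abs, abs_div, Nat.abs_cast]
    gcongr
    exact abs_log_qDen_sub_birkhoffSum_le hx n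
  have := h0.add h
  rw [zero_add] at this
  refine this.congr fun n => ?_
  ring

lemma ae_mem_unitIrrationals_tendsto :
    ∀ᵐ x ∂(volume.restrict (Set.Ioc (0 : ℝ) 1)), x ∈ unitIrrationals ∧ ∃ L : ℝ, Tendsto
      (fun n : ℕ => birkhoffSum gaussMap (fun y => -Real.log y) n x / n) atTop (𝓝 L) := by
  have hrat : ∀ᵐ x ∂(volume.restrict (Set.Ioc (0 : ℝ) 1)), Irrational x :=
    ae_restrict_of_ae ((Set.countable_range ((↑) : ℚ → ℝ)).ae_notMem volume)
  filter_upwards [hrat, ae_exists_tendsto_birkhoffSum_neg_log, ae_restrict_mem measurableSet_Ioc]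
    with x hx hlim hmem
  exact ⟨⟨⟨hmem.1, lt_of_le_of_ne hmem.2 hx.ne_one⟩, hx⟩, hlim⟩

/-- The exceptional set is Lebesgue null. -/
theorem volume_exceptionalSet : volume exceptionalSet = 0 := by
  have h := (ae_restrict_iff' measurableSet_Ioc).1 ae_mem_unitIrrationals_tendsto
  rw [measure_eq_zero_iff_ae_notMem]
  filter_upwards [h] with x hx' hx
  obtain ⟨hmem, L, hL⟩ := hx' ⟨hx.1.1, hx.1.2.le⟩
  exact hx.2.2 ⟨L, tendsto_log_qDen_div hmem hL⟩

end NullSet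

section Dimension

lemma tendsto_sub_div_of_tendsto_div {u : ℕ → ℝ} {L : ℝ}
    (h : Tendsto (fun n : ℕ => u n / n) atTop (𝓝 L)) :
    Tendsto (fun n : ℕ => (u (n + 1) - u n) / n) atTop (𝓝 0) := by
  have h1 : Tendsto (fun n : ℕ => u (n + 1) / (n + 1 : ℕ)) atTop (𝓝 L) :=
    h.comp (tendsto_add_atTop_nat 1)
  have h2 : Tendsto (fun n : ℕ => 1 + 1 / (n : ℝ)) atTop (𝓝 1) := by
    simpa using (tendsto_const_div_atTop_nhds_zero_nat (1 : ℝ)).const_add 1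
  have h3 := (h1.mul h2).sub h
  rw [mul_one, sub_self] at h3
  refine h3.congr' ?_
  filter_upwards [eventually_gt_atTop 0] with n hn
  have hn' : (n : ℝ) ≠ 0 := by exact_mod_cast hn.ne'
  have hn1 : (n : ℝ) + 1 ≠ 0 := by positivity
  push_cast
  field_simp

/-- The sparse weights multiplying the digits: `2 ^ (n / K)` when `n` is a power of two, and `1`
otherwise. -/
def sparseWeight (K n : ℕ) : ℤ := if n = 2 ^ Nat.log 2 n then 2 ^ (n / K) else 1

lemma one_le_sparseWeight (K n : ℕ) : 1 ≤ sparseWeight K n := by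
  unfold sparseWeight
  split_ifs
  · exact one_le_pow₀ (by norm_num)
  · exact le_rfl

lemma sparseWeight_two_pow (K k : ℕ) : sparseWeight K (2 ^ k) = 2 ^ (2 ^ k / K) := by
  rw [sparseWeight, Nat.log_pow one_lt_two, if_pos rfl]

lemma sum_two_pow_lt (n : ℕ) :
    ∑ i ∈ Finset.range n, (if i = 2 ^ Nat.log 2 i then i else 0) ≤ 2 * n := by
  rcases Nat.eq_zero_or_pos n with rfl | hn
  · simp
  have hgeom : ∀ m : ℕ, ∑ k ∈ Finset.range m, 2 ^ k < 2 ^ m := fun m => by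
    induction m with
    | zero => simp
    | succ m ih => rw [Finset.sum_range_succ, pow_succ]; omega
  rw [← Finset.sum_filter]
  have hsub : (Finset.range n).filter (fun i => i = 2 ^ Nat.log 2 i) ⊆
      (Finset.range (Nat.log 2 n + 1)).image (2 ^ ·) := by
    intro i hi
    rw [Finset.mem_filter, Finset.mem_range] at hi
    refine Finset.mem_image.2 ⟨Nat.log 2 i, Finset.mem_range.2 ?_, hi.2.symm⟩
    exact Nat.lt_succ_of_le (Nat.log_mono_right hi.1.le)
  calc ∑ i ∈ (Finset.range n).filter (fun i => i = 2 ^ Nat.log 2 i), i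
      ≤ ∑ i ∈ (Finset.range (Nat.log 2 n + 1)).image (2 ^ ·), i :=
        Finset.sum_le_sum_of_subset hsub
    _ = ∑ k ∈ Finset.range (Nat.log 2 n + 1), 2 ^ k :=
        Finset.sum_image fun i _ j _ h => Nat.pow_right_injective le_rfl h
    _ ≤ 2 ^ (Nat.log 2 n + 1) := (hgeom _).le
    _ = 2 * 2 ^ Nat.log 2 n := pow_succ' _ _
    _ ≤ 2 * n := by gcongr; exact Nat.pow_log_le_self 2 hn.ne'

lemma two_pow_div_le {K : ℕ} {θ : ℝ} (hθ : 1 ≤ θ) (hθK : θ ^ K = 2) (n : ℕ) :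
    (2 : ℝ) ^ (n / K) ≤ θ ^ n := by
  rw [← hθK, ← pow_mul]
  exact pow_le_pow_right₀ hθ (Nat.mul_div_le n K)

lemma sparseWeight_le {K : ℕ} {θ : ℝ} (hθ : 1 ≤ θ) (hθK : θ ^ K = 2) (n : ℕ) :
    (sparseWeight K n : ℝ) ≤ θ ^ n := by
  unfold sparseWeight
  split_ifs
  · push_cast
    exact two_pow_div_le hθ hθK n
  · push_cast
    exact one_le_pow₀ hθ

lemma prod_sparseWeight_le {K : ℕ} {θ : ℝ} (hθ : 1 ≤ θ) (hθK : θ ^ K = 2) (n : ℕ) :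
    ∏ i ∈ Finset.range n, (sparseWeight K i : ℝ) ≤ θ ^ (2 * n) := by
  refine le_trans ?_ (pow_le_pow_right₀ hθ (sum_two_pow_lt n))
  rw [← Finset.prod_pow_eq_pow_sum]
  refine Finset.prod_le_prod (fun i _ => ?_) fun i _ => ?_
  · exact_mod_cast zero_le_one.trans (one_le_sparseWeight K i)
  · unfold sparseWeight
    split_ifs
    · push_cast
      exact two_pow_div_le hθ hθK i
    · simp

lemma qq_le_mul_prod {a b w : ℕ → ℤ} (ha : ∀ n, 1 ≤ a (n + 1)) (hw : ∀ n, 1 ≤ w n)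
    (hb : ∀ n, b (n + 1) = a (n + 1) * w n) (n : ℕ) :
    qq b (n + 1) ≤ qq a (n + 1) * ∏ i ∈ Finset.range n, w i ∧
      qq b n ≤ qq a n * ∏ i ∈ Finset.range n, w i := by
  induction n with
  | zero => simp [qq]
  | succ n ih =>
    have hP : 0 ≤ ∏ i ∈ Finset.range n, w i :=
      Finset.prod_nonneg fun i _ => zero_le_one.trans (hw i)
    have h0 := (qq_nonneg_and_le ha n).1
    have h1 := (qq_nonneg_and_le ha (n + 1)).1
    have hle : ∏ i ∈ Finset.range n, w i ≤ ∏ i ∈ Finset.range (n + 1), w i := by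
      rw [Finset.prod_range_succ]
      exact le_mul_of_one_le_right hP (hw n)
    refine ⟨?_, ih.1.trans (mul_le_mul_of_nonneg_left hle h1)⟩
    calc qq b (n + 2) = b (n + 1) * qq b (n + 1) + qq b n := rfl
      _ = a (n + 1) * w n * qq b (n + 1) + qq b n := by rw [hb]
      _ ≤ a (n + 1) * w n * (qq a (n + 1) * ∏ i ∈ Finset.range n, w i) +
          qq a n * ∏ i ∈ Finset.range (n + 1), w i := by
        refine add_le_add (mul_le_mul_of_nonneg_left ih.1 ?_)
          (ih.2.trans (mul_le_mul_of_nonneg_left hle h0))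
        exact mul_nonneg (zero_le_one.trans (ha n)) (zero_le_one.trans (hw n))
      _ = (a (n + 1) * qq a (n + 1) + qq a n) * ∏ i ∈ Finset.range (n + 1), w i := by
        rw [Finset.prod_range_succ]; ring
      _ = qq a (n + 2) * ∏ i ∈ Finset.range (n + 1), w i := rfl

/-- `x` is obtained from `x'` by multiplying the digits by the sparse weights. -/
def IsSparseScaling (K : ℕ) (x' x : ℝ) : Prop :=
  x ∈ unitIrrationals ∧ x' ∈ unitIrrationals ∧
    ∀ n, digit x (n + 1) = digit x' (n + 1) * sparseWeight K n

lemma mem_exceptionalSet_of_isSparseScaling {K : ℕ} (hK : 0 < K) {x' x : ℝ}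
    (h : IsSparseScaling K x' x) : x ∈ exceptionalSet := by
  obtain ⟨hx, hx', hd⟩ := h
  refine ⟨hx.1, hx.2, ?_⟩
  rintro ⟨L, hL⟩
  have hlim := (tendsto_sub_div_of_tendsto_div hL).comp
    (tendsto_pow_atTop_atTop_of_one_lt (r := 2) one_lt_two)
  have hK' : (0 : ℝ) < K := by exact_mod_cast hK
  have hlog : 0 < Real.log 2 := Real.log_pos one_lt_two
  have hev := hlim.eventually_lt_const (show 0 < Real.log 2 / (2 * K) by positivity)
  obtain ⟨k, hk, hkK⟩ := (hev.and (eventually_ge_atTop K)).exists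
  simp only [Function.comp_apply] at hk
  set n := 2 ^ k with hn
  have hnK : K ≤ n := hkK.trans Nat.lt_two_pow_self.le
  have hn0 : (0 : ℝ) < n := by exact_mod_cast hK.trans_le hnK
  have hq1 := one_le_qDen hx n
  have hdigit : (2 : ℤ) ^ (n / K) ≤ digit x (n + 1) := by
    rw [hd n, hn, sparseWeight_two_pow]
    exact le_mul_of_one_le_left (by positivity) (one_le_digit hx' _)
  have hdigit' : (2 : ℝ) ^ (n / K) ≤ digit x (n + 1) := by exact_mod_cast hdigit
  have hq2 : (2 : ℝ) ^ (n / K) * qDen x (n + 1) ≤ qDen x (n + 1 + 1) := by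
    have h1 : (qDen x (n + 1 + 1) : ℝ) = digit x (n + 1) * qDen x (n + 1) + qDen x n := by
      simp [qDen, qq]
    have h2 : (0 : ℝ) ≤ qDen x n := by exact_mod_cast (qq_nonneg_and_le (one_le_digit hx) n).1
    rw [h1]
    nlinarith
  have hlog2 := Real.log_le_log (by positivity) hq2
  rw [Real.log_mul (by positivity) (by positivity), Real.log_pow] at hlog2
  have hdiv : (n : ℝ) ≤ 2 * K * (n / K : ℕ) := by
    have h1 : 1 ≤ n / K := (Nat.one_le_div_iff hK).2 hnK
    have h2 := Nat.div_add_mod n K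
    have h3 := Nat.mod_lt n hK
    have h4 : n ≤ 2 * K * (n / K) := by nlinarith
    exact_mod_cast h4
  rw [div_lt_div_iff₀ hn0 (by positivity)] at hk
  nlinarith

lemma exists_isSparseScaling (K : ℕ) {x' : ℝ} (hx' : x' ∈ unitIrrationals) :
    ∃ x, IsSparseScaling K x' x := by
  obtain ⟨x, hx, hd⟩ := exists_digit_eq (fun n => digit x' (n + 1) * sparseWeight K n)
    fun n => one_le_mul_of_one_le_of_one_le (one_le_digit hx' n) (one_le_sparseWeight K n)
  exact ⟨x, hx, hx', hd⟩

lemma IsSparseScaling.orbitProd_le {K : ℕ} {θ : ℝ} (hθ : 1 ≤ θ) (hθK : θ ^ K = 2) {x' x : ℝ}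
    (h : IsSparseScaling K x' x) (n : ℕ) : orbitProd x' n ≤ 2 * θ ^ (2 * n) * orbitProd x n := by
  obtain ⟨hx, hx', hd⟩ := h
  have hp := orbitProd_pos hx n
  have hp' := orbitProd_pos hx' n
  have hq : (qDen x (n + 1) : ℝ) ≤ qDen x' (n + 1) * θ ^ (2 * n) := by
    have h1 : (qDen x (n + 1) : ℝ) ≤
        qDen x' (n + 1) * ∏ i ∈ Finset.range n, (sparseWeight K i : ℝ) := by
      exact_mod_cast (qq_le_mul_prod (one_le_digit hx') (one_le_sparseWeight K) hd n).1
    exact h1.trans (mul_le_mul_of_nonneg_left (prod_sparseWeight_le hθ hθK n)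
      (zero_le_one.trans (one_le_qDen hx' n)))
  calc orbitProd x' n ≤ orbitProd x' n * (2 * qDen x (n + 1) * orbitProd x n) :=
        le_mul_of_one_le_right hp'.le (one_le_two_mul_qDen_mul_orbitProd hx n)
    _ ≤ orbitProd x' n * (2 * (qDen x' (n + 1) * θ ^ (2 * n)) * orbitProd x n) := by gcongr
    _ = (qDen x' (n + 1) * orbitProd x' n) * (2 * θ ^ (2 * n) * orbitProd x n) := by ring
    _ ≤ 2 * θ ^ (2 * n) * orbitProd x n :=
        mul_le_of_le_one_left (by positivity) (qDen_mul_orbitProd_le_one hx' n)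

/-- The points whose orbit under the Gauss map approaches `0` at most at the rate `θ ^ (-n)`. -/
def slowApproach (θ C : ℝ) : Set ℝ :=
  {x | x ∈ unitIrrationals ∧ ∀ n : ℕ, 1 ≤ C * θ ^ n * gaussMap^[n] x}

lemma IsSparseScaling.one_le_mul_iterate {K : ℕ} {θ C : ℝ} (hθ : 1 ≤ θ) (hθK : θ ^ K = 2)
    {x' x : ℝ} (h : IsSparseScaling K x' x) (hs : x' ∈ slowApproach θ C) (n : ℕ) :
    1 ≤ 2 * C * θ ^ (2 * n) * gaussMap^[n] x := by
  obtain ⟨hx, hx', hd⟩ := h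
  have hp := iterate_gaussMap_pos hx n
  have hp' := iterate_gaussMap_pos hx' n
  have hθn : 0 < θ ^ n := by positivity
  have hd' : (digit x (n + 1) : ℝ) = digit x' (n + 1) * sparseWeight K n := by
    exact_mod_cast hd n
  have h1 : (digit x' (n + 1) : ℝ) ≤ C * θ ^ n := by
    have h2 := iterate_gaussMap_mul hx' n
    have h3 := iterate_gaussMap_pos hx' (n + 1)
    have h4 : digit x' (n + 1) * gaussMap^[n] x' ≤ C * θ ^ n * gaussMap^[n] x' := by
      nlinarith [hs.2 n, mul_pos hp' h3]
    exact le_of_mul_le_mul_right h4 hp'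
  have h2 : (digit x (n + 1) : ℝ) ≤ C * θ ^ (2 * n) := by
    rw [hd']
    calc (digit x' (n + 1) * sparseWeight K n : ℝ) ≤ (C * θ ^ n) * θ ^ n :=
          mul_le_mul h1 (sparseWeight_le hθ hθK n)
            (by exact_mod_cast zero_le_one.trans (one_le_sparseWeight K n))
            ((zero_le_one.trans (one_le_digit_cast hx' n)).trans h1)
      _ = C * θ ^ (2 * n) := by ring
  have h3 := iterate_gaussMap_mul hx n
  have h4 : gaussMap^[n + 1] x ≤ digit x (n + 1) :=
    (iterate_gaussMap_lt_one hx _).le.trans (one_le_digit_cast hx n)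
  nlinarith

/-- The Hölder estimate for the inverse of the digit scaling, in polynomial form. -/
lemma IsSparseScaling.abs_sub_pow_le {K : ℕ} {θ C : ℝ} (hθ : 1 ≤ θ) (hθK : θ ^ K = 2)
    {x' x y' y : ℝ} (hx : IsSparseScaling K x' x) (hy : IsSparseScaling K y' y)
    (hsx : x' ∈ slowApproach θ C) (hsy : y' ∈ slowApproach θ C) :
    |x' - y'| ^ (K + 16) ≤ 2 ^ 16 * (4 * (2 * C) ^ 6 * θ ^ 12) ^ K * |x - y| ^ K := by
  have hC : 0 < C := by
    have h1 := hsx.2 0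
    have h2 := hsx.1.1.1
    simp only [pow_zero, mul_one, Function.iterate_zero, id] at h1
    by_contra h
    nlinarith
  have hθ0 : 0 < θ := by linarith
  by_cases hne : x' = y'
  · rw [hne, sub_self, abs_zero, zero_pow (by omega)]
    positivity
  obtain ⟨m, hm, hm'⟩ := exists_first_digit_ne hx.2.1 hy.2.1 hne
  have heq : ∀ k < m, digit x (k + 1) = digit y (k + 1) := fun k hk => by
    rw [hx.2.2, hy.2.2, hm k hk]
  have hdne : digit x (m + 1) ≠ digit y (m + 1) := by
    rw [hx.2.2, hy.2.2]
    exact fun h => hm' (mul_right_cancel₀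
      (zero_lt_one.trans_le (one_le_sparseWeight K m)).ne' h)
  have hΔ := abs_sub_le_of_digit_eq hx.2.1 hy.2.1 m hm
  have hρ := orbitProd_mul_orbitProd_le hx.2.1 hy.2.1 m
  set ρ := orbitProd x' m * orbitProd y' m with hρ_def
  have hρ0 : 0 < ρ := mul_pos (orbitProd_pos hx.2.1 m) (orbitProd_pos hy.2.1 m)
  have hsep := le_abs_sub_of_digit_ne hx.1 hy.1 m hdne
  have hxy := abs_sub_eq_of_digit_eq hx.1 hy.1 m heq
  have hρ' : ρ ≤ 4 * θ ^ (4 * m) * (orbitProd x m * orbitProd y m) := by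
    calc ρ ≤ (2 * θ ^ (2 * m) * orbitProd x m) * (2 * θ ^ (2 * m) * orbitProd y m) :=
          mul_le_mul (hx.orbitProd_le hθ hθK m) (hy.orbitProd_le hθ hθK m)
            (orbitProd_pos hy.2.1 m).le
            (mul_nonneg (by positivity) (orbitProd_pos hx.1 m).le)
      _ = 4 * θ ^ (4 * m) * (orbitProd x m * orbitProd y m) := by ring
  have hxp := iterate_gaussMap_pos hx.1
  have hyp := iterate_gaussMap_pos hy.1
  have hx1 := hx.one_le_mul_iterate hθ hθK hsx
  have hy1 := hy.one_le_mul_iterate hθ hθK hsy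
  have hsep' : 1 ≤ (2 * C) ^ 6 * θ ^ (12 * m + 12) * |gaussMap^[m] x - gaussMap^[m] y| := by
    have h1 := one_le_mul_of_one_le_of_one_le
      (one_le_mul_of_one_le_of_one_le (hx1 m) (hy1 m))
      (one_le_mul_of_one_le_of_one_le
        (one_le_mul_of_one_le_of_one_le (hx1 (m + 1)) (hx1 (m + 2)))
        (one_le_mul_of_one_le_of_one_le (hy1 (m + 1)) (hy1 (m + 2))))
    refine h1.trans (le_trans (le_of_eq ?_) (mul_le_mul_of_nonneg_left hsep (by positivity)))
    ring
  have hmain : ρ ≤ 4 * (2 * C) ^ 6 * θ ^ 12 * θ ^ (16 * m) * |x - y| := by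
    calc ρ ≤ ρ * ((2 * C) ^ 6 * θ ^ (12 * m + 12) * |gaussMap^[m] x - gaussMap^[m] y|) :=
          le_mul_of_one_le_right hρ0.le hsep'
      _ ≤ 4 * θ ^ (4 * m) * (orbitProd x m * orbitProd y m) *
          ((2 * C) ^ 6 * θ ^ (12 * m + 12) * |gaussMap^[m] x - gaussMap^[m] y|) :=
          mul_le_mul_of_nonneg_right hρ' (by positivity)
      _ = 4 * (2 * C) ^ 6 * θ ^ 12 * θ ^ (16 * m) * |x - y| := by rw [hxy]; ring
  have hθm : θ ^ (16 * m * K) * ρ ^ 16 ≤ 2 ^ 16 := by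
    have h1 : θ ^ (16 * m * K) = (2 ^ m) ^ 16 := by
      rw [mul_comm, pow_mul, hθK]
      ring
    rw [h1, ← mul_pow]
    refine pow_le_pow_left₀ (by positivity) ?_ 16
    calc 2 ^ m * ρ ≤ 2 ^ m * (2 * (1 / 2) ^ m) := by gcongr
      _ = 2 * (2 * (1 / 2)) ^ m := by rw [mul_pow]; ring
      _ = 2 := by norm_num
  calc |x' - y'| ^ (K + 16) ≤ ρ ^ (K + 16) := pow_le_pow_left₀ (abs_nonneg _) hΔ _
    _ = ρ ^ K * ρ ^ 16 := pow_add _ _ _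
    _ ≤ (4 * (2 * C) ^ 6 * θ ^ 12 * θ ^ (16 * m) * |x - y|) ^ K * ρ ^ 16 := by gcongr
    _ = (4 * (2 * C) ^ 6 * θ ^ 12) ^ K * |x - y| ^ K * (θ ^ (16 * m * K) * ρ ^ 16) := by
        rw [mul_pow, mul_pow _ (θ ^ (16 * m)), ← pow_mul]; ring
    _ ≤ (4 * (2 * C) ^ 6 * θ ^ 12) ^ K * |x - y| ^ K * 2 ^ 16 := by gcongr
    _ = 2 ^ 16 * (4 * (2 * C) ^ 6 * θ ^ 12) ^ K * |x - y| ^ K := by ring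

lemma holderOnWith_of_abs_sub_pow_le {f : ℝ → ℝ} {s : Set ℝ} {A : ℝ} {p q : ℕ} (hp : 0 < p)
    (h : ∀ x ∈ s, ∀ y ∈ s, |f x - f y| ^ p ≤ A * |x - y| ^ q) :
    HolderOnWith (A.toNNReal ^ (1 / p : ℝ)) (q / p) f s := by
  intro x hx y hy
  have hp' : (p : ℝ) ≠ 0 := by exact_mod_cast hp.ne'
  have hNN : nndist (f x) (f y) ^ p ≤ A.toNNReal * nndist x y ^ q := by
    rw [← NNReal.coe_le_coe]
    push_cast
    rw [Real.dist_eq, Real.dist_eq]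
    exact (h x hx y hy).trans (mul_le_mul_of_nonneg_right (le_max_left _ _) (by positivity))
  have hroot : nndist (f x) (f y) ≤
      A.toNNReal ^ (1 / p : ℝ) * nndist x y ^ ((q / p : NNReal) : ℝ) := by
    have h1 := NNReal.rpow_le_rpow hNN (show (0 : ℝ) ≤ 1 / p by positivity)
    rw [NNReal.mul_rpow, ← NNReal.rpow_natCast, ← NNReal.rpow_natCast, ← NNReal.rpow_mul,
      ← NNReal.rpow_mul, mul_one_div_cancel hp', NNReal.rpow_one, mul_one_div] at h1
    simpa using h1
  rw [edist_nndist, edist_nndist, ← ENNReal.coe_rpow_of_nonneg _ (NNReal.coe_nonneg _),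
    ← ENNReal.coe_mul]
  exact ENNReal.coe_le_coe.2 hroot

lemma mem_iUnion_slowApproach {θ : ℝ} (hθ : 1 < θ) {x L : ℝ} (hx : x ∈ unitIrrationals)
    (h : Tendsto (fun n : ℕ => birkhoffSum gaussMap (fun y => -Real.log y) n x / n)
      atTop (𝓝 L)) : x ∈ ⋃ C : ℕ, slowApproach θ C := by
  have hlim := tendsto_sub_div_of_tendsto_div h
  have hev := hlim.eventually_lt_const (Real.log_pos hθ)
  obtain ⟨N, hN⟩ := eventually_atTop.1 hev
  have hpos := iterate_gaussMap_pos hx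
  obtain ⟨C, hC⟩ := exists_nat_ge (1 + ∑ n ∈ Finset.range (N + 1), 1 / gaussMap^[n] x)
  have hsum : ∀ n < N + 1, 1 / gaussMap^[n] x ≤
      ∑ n ∈ Finset.range (N + 1), 1 / gaussMap^[n] x := fun n hn =>
    Finset.single_le_sum (f := fun n => 1 / gaussMap^[n] x)
      (fun i _ => (one_div_pos.2 (hpos i)).le) (Finset.mem_range.2 hn)
  have hsum0 : 0 ≤ ∑ n ∈ Finset.range (N + 1), 1 / gaussMap^[n] x :=
    Finset.sum_nonneg fun i _ => (one_div_pos.2 (hpos i)).le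
  have hθ0 : 0 < θ := by linarith
  refine Set.mem_iUnion.2 ⟨C, hx, fun n => ?_⟩
  rcases lt_or_ge n (N + 1) with hn | hn
  · have h1 : 1 / gaussMap^[n] x ≤ C := by linarith [hsum n hn]
    rw [div_le_iff₀ (hpos n)] at h1
    refine h1.trans (mul_le_mul_of_nonneg_right ?_ (hpos n).le)
    exact le_mul_of_one_le_right (Nat.cast_nonneg C) (one_le_pow₀ hθ.le)
  · have h1 := hN n (by omega)
    have hn0 : (0 : ℝ) < n := by exact_mod_cast (by omega : 0 < n)
    rw [birkhoffSum_succ, add_sub_cancel_left, div_lt_iff₀ hn0] at h1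
    have h2 : 0 ≤ Real.log (θ ^ n * gaussMap^[n] x) := by
      rw [Real.log_mul (by positivity) (hpos n).ne', Real.log_pow]
      linarith
    have h3 : 1 ≤ θ ^ n * gaussMap^[n] x := by
      by_contra! hlt
      exact absurd (Real.log_neg (mul_pos (by positivity) (hpos n)) hlt) (not_lt.2 h2)
    rw [mul_assoc]
    exact one_le_mul_of_one_le_of_one_le (by linarith) h3

lemma one_le_dimH_of_volume_ne_zero {s : Set ℝ} (h : volume s ≠ 0) : 1 ≤ dimH s := by
  have := le_dimH_of_hausdorffMeasure_ne_zero (s := s) (d := 1)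
    (by rwa [NNReal.coe_one, hausdorffMeasure_real])
  simpa using this

lemma exists_one_le_dimH_slowApproach {θ : ℝ} (hθ : 1 < θ) :
    ∃ C : ℕ, 1 ≤ dimH (slowApproach θ C) := by
  by_contra! hcon
  have hnull : volume (⋃ C : ℕ, slowApproach θ C) = 0 := measure_iUnion_null fun C => by
    by_contra h
    exact absurd (one_le_dimH_of_volume_ne_zero h) (not_le.2 (hcon C))
  have hfull := (ae_restrict_iff' measurableSet_Ioc).1 ae_mem_unitIrrationals_tendsto
  have hIoc : volume (Set.Ioc (0 : ℝ) 1) = 0 := by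
    rw [measure_eq_zero_iff_ae_notMem]
    filter_upwards [hfull, measure_eq_zero_iff_ae_notMem.1 hnull] with x hx hx' hmem
    obtain ⟨hirr, L, hL⟩ := hx hmem
    exact hx' (mem_iUnion_slowApproach hθ hirr hL)
  simp at hIoc

lemma div_le_dimH_exceptionalSet {K : ℕ} (hK : 0 < K) :
    (((K : NNReal) / ((K + 16 : ℕ) : NNReal) : NNReal) : ENNReal) ≤ dimH exceptionalSet := by
  have hK' : (K : ℝ) ≠ 0 := by exact_mod_cast hK.ne'
  set θ : ℝ := 2 ^ (1 / K : ℝ)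
  have hθ : 1 < θ := Real.one_lt_rpow one_lt_two (by positivity)
  have hθK : θ ^ K = 2 := by
    rw [← Real.rpow_natCast, ← Real.rpow_mul (by norm_num), one_div_mul_cancel hK', Real.rpow_one]
  obtain ⟨C, hC⟩ := exists_one_le_dimH_slowApproach hθ
  choose! φ hφ using fun x' (hx' : x' ∈ slowApproach θ C) => exists_isSparseScaling K hx'.1
  choose! ψ hψ using fun x (hx : x ∈ φ '' slowApproach θ C) =>
    (show ∃ x' ∈ slowApproach θ C, φ x' = x from hx)
  have hψφ : ∀ x ∈ φ '' slowApproach θ C, IsSparseScaling K (ψ x) x := fun x hx => by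
    have := hφ (ψ x) (hψ x hx).1
    rwa [(hψ x hx).2] at this
  have hest := fun x hx y hy =>
    (hψφ x hx).abs_sub_pow_le hθ.le hθK (hψφ y hy) (hψ x hx).1 (hψ y hy).1
  have hholder := holderOnWith_of_abs_sub_pow_le (by omega) hest
  have himage : ψ '' (φ '' slowApproach θ C) = slowApproach θ C := by
    rw [Set.image_image]
    refine (Set.image_congr fun x' hx' => ?_).trans (Set.image_id' _)
    have hmem := Set.mem_image_of_mem φ hx'
    have h0 := (hφ x' hx').abs_sub_pow_le hθ.le hθK (hψφ _ hmem) hx' (hψ _ hmem).1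
    rw [sub_self, abs_zero, zero_pow hK.ne', mul_zero] at h0
    have h1 := pow_eq_zero_iff (by omega) |>.1 (le_antisymm h0 (by positivity))
    linarith [abs_eq_zero.1 h1]
  have hdim := hholder.dimH_image_le (by positivity)
  rw [himage] at hdim
  have hsub : φ '' slowApproach θ C ⊆ exceptionalSet := fun x hx =>
    mem_exceptionalSet_of_isSparseScaling hK (hψφ x hx)
  have h1 := (hC.trans hdim).trans (ENNReal.div_le_div_right (dimH_mono hsub) _)
  rw [ENNReal.le_div_iff_mul_le (Or.inl (by positivity)) (Or.inl ENNReal.coe_ne_top),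
    one_mul] at h1
  exact h1

/-- The exceptional set has full Hausdorff dimension. -/
theorem dimH_exceptionalSet : dimH exceptionalSet = 1 := by
  refine le_antisymm ((dimH_mono (Set.subset_univ _)).trans_eq Real.dimH_univ) ?_
  have hlim : Tendsto (fun K : ℕ => (((K : NNReal) / ((K + 16 : ℕ) : NNReal) : NNReal) : ENNReal))
      atTop (𝓝 1) := by
    rw [← ENNReal.coe_one, ENNReal.tendsto_coe, ← NNReal.tendsto_coe]
    push_cast
    exact tendsto_natCast_div_add_atTop (16 : ℝ)
  refine le_of_tendsto hlim ?_
  filter_upwards [eventually_gt_atTop 0] with K hK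
  exact div_le_dimH_exceptionalSet hK

end Dimension

/-- (Pollicott–Weiss) The exceptional set has Lebesgue measure zero and Hausdorff
dimension one. -/
theorem statement8 :
    volume exceptionalSet = 0 ∧ dimH exceptionalSet = 1 :=
  ⟨volume_exceptionalSet, dimH_exceptionalSet⟩
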